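/- For shuffled SGD run with one fixed permutation π^{(0)} (incremental gradient), each ℓ_i convex and L_i-smooth, and any fixed v ∈ ℝⁿ: the term 𝒯₂ := (η_k/n)∑_{i=1}^m (v^{(i)} − y_k^{(i)})^⊤A^{(i)}(x_k − x_{k−1,i}) satisfies 𝒯₂ ≤ (η_k³ n/b²)·L̂₀L̃₀·‖y_k − y_*‖²_{Λ^{-1}} + (η_k/(2n))‖v − y_k‖²_{Λ^{-1}} + min{ (η_k³ n/b²)·L̂₀L̃₀·‖y_*‖²_{Λ^{-1}}, (η_k³(n−b)²/b²)·L̃₀·σ_*² }, where L̂₀ = L̂_{π^{(0)}} and L̃₀ = L̃_{π^{(0)}}. -/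

import Mathlib

open Finset Matrix

namespace SSGD

/-- squared Euclidean norm of a finite vector -/
noncomputable def sq {ι : Type*} [Fintype ι] (x : ι → ℝ) : ℝ := ∑ i, (x i) ^ 2

/-- Euclidean dot product -/
noncomputable def dot {ι : Type*} [Fintype ι] (x y : ι → ℝ) : ℝ := ∑ i, x i * y i

/-- weighted squared norm `‖u‖²_{(diag w)⁻¹} = ∑ i, (u i)² / w i` -/
noncomputable def wsq {ι : Type*} [Fintype ι] (w u : ι → ℝ) : ℝ := ∑ i, (u i) ^ 2 / w i

/-- operator (spectral) norm of a real matrix -/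
noncomputable def opNorm {α β : Type*} [Fintype α] [Fintype β] [DecidableEq β]
    (M : Matrix α β ℝ) : ℝ :=
  ‖LinearMap.toContinuousLinearMap (Matrix.toEuclideanLin M)‖

/-- `0`-based global index of the `j`-th element of the `i`-th batch of size `b` -/
def idx (b m : ℕ) (i : Fin m) (j : Fin b) : Fin (b * m) :=
  ⟨b * i.1 + j.1, by
    have hi : i.1 + 1 ≤ m := i.2
    have hj : j.1 < b := j.2
    calc b * i.1 + j.1 < b * i.1 + b := by omega
      _ = b * (i.1 + 1) := by ring
      _ ≤ b * m := Nat.mul_le_mul (le_refl b) hi⟩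

/-- `I_{j↑}` : the identity matrix with its first `j` diagonal entries zeroed out -/
noncomputable def Iup (n j : ℕ) : Matrix (Fin n) (Fin n) ℝ :=
  Matrix.diagonal fun i => if j ≤ i.1 then 1 else 0

/-- `I_{(j)}` (`j` 0-based) : diagonal matrix with ones exactly in positions
`b*j, …, b*(j+1)-1` -/
noncomputable def Iblk (n b j : ℕ) : Matrix (Fin n) (Fin n) ℝ :=
  Matrix.diagonal fun i => if b * j ≤ i.1 ∧ i.1 < b * (j + 1) then 1 else 0

variable {d b m : ℕ}

/-- the row-permuted data matrix `A_π` (row `i` of `A_π` is row `π i` of `A`) -/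
def permMat (A : Matrix (Fin (b * m)) (Fin d) ℝ) (π : Equiv.Perm (Fin (b * m))) :
    Matrix (Fin (b * m)) (Fin d) ℝ :=
  A.submatrix π id

/-- `Ĉ_π = (1/(m·n)) ‖W_π^{1/2} (∑_{j=1}^m I_{b(j-1)↑} A_π A_πᵀ I_{b(j-1)↑}) W_π^{1/2}‖₂`;
this is `L̂_π` for `w = L` and `Ĝ_π` for `w = G²`. -/
noncomputable def hatC (A : Matrix (Fin (b * m)) (Fin d) ℝ) (w : Fin (b * m) → ℝ)
    (π : Equiv.Perm (Fin (b * m))) : ℝ :=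
  (1 / ((m : ℝ) * ((b * m : ℕ) : ℝ))) * opNorm
    (Matrix.diagonal (fun i => Real.sqrt (w (π i))) *
      (∑ j : Fin m,
        Iup (b * m) (b * j.1) * (permMat A π * (permMat A π)ᵀ) * Iup (b * m) (b * j.1)) *
      Matrix.diagonal (fun i => Real.sqrt (w (π i))))

/-- `C̃_π = (1/b) ‖W_π^{1/2} (∑_{j=1}^m I_{(j)} A_π A_πᵀ I_{(j)}) W_π^{1/2}‖₂`;
this is `L̃_π` for `w = L` and `G̃_π` for `w = G²`. -/
noncomputable def tilC (A : Matrix (Fin (b * m)) (Fin d) ℝ) (w : Fin (b * m) → ℝ)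
    (π : Equiv.Perm (Fin (b * m))) : ℝ :=
  (1 / (b : ℝ)) * opNorm
    (Matrix.diagonal (fun i => Real.sqrt (w (π i))) *
      (∑ j : Fin m,
        Iblk (b * m) b j.1 * (permMat A π * (permMat A π)ᵀ) * Iblk (b * m) b j.1) *
      Matrix.diagonal (fun i => Real.sqrt (w (π i))))

/-- one inner (mini-batch) step of shuffled SGD, using the (sub)gradient selection `g` -/
noncomputable def step (A : Matrix (Fin (b * m)) (Fin d) ℝ) (g : Fin (b * m) → ℝ → ℝ)
    (η : ℝ) (π : Equiv.Perm (Fin (b * m))) (i : Fin m) (x : Fin d → ℝ) : Fin d → ℝ :=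
  fun t => x t - (η / (b : ℝ)) *
    ∑ j : Fin b, g (π (idx b m i j)) (dot (A (π (idx b m i j))) x) * A (π (idx b m i j)) t

/-- the primal iterates `x_{k-1,1}, …, x_{k-1,m+1}` within a single epoch
(`inIter A g η π x0 i` is `x_{k-1,i+1}`, so `inIter … 0 = x_{k-1}` and
`inIter … m = x_k`) -/
noncomputable def inIter (A : Matrix (Fin (b * m)) (Fin d) ℝ) (g : Fin (b * m) → ℝ → ℝ)
    (η : ℝ) (π : Equiv.Perm (Fin (b * m))) (x0 : Fin d → ℝ) : ℕ → Fin d → ℝ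
  | 0 => x0
  | i + 1 =>
    if h : i < m then step A g η π ⟨i, h⟩ (inIter A g η π x0 i) else inIter A g η π x0 i

/-- the dual vector `y_k` of one epoch, in permuted coordinates: its `p`-th entry is
`g_{π(p)}(a_{π(p)}ᵀ x_{k-1,i})` where `i` is the batch containing position `p` -/
noncomputable def dualY (A : Matrix (Fin (b * m)) (Fin d) ℝ) (g : Fin (b * m) → ℝ → ℝ)
    (η : ℝ) (π : Equiv.Perm (Fin (b * m))) (x0 : Fin d → ℝ) : Fin (b * m) → ℝ :=
  fun p => g (π p) (dot (A (π p)) (inIter A g η π x0 (p.1 / b)))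

/-- multi-epoch shuffled SGD: `xSeq A g η πs x0 k` is the iterate after `k` full epochs;
the (0-based) epoch `k` uses the permutation `πs k` and the step size `η k`. -/
noncomputable def xSeq (A : Matrix (Fin (b * m)) (Fin d) ℝ) (g : Fin (b * m) → ℝ → ℝ)
    (η : ℕ → ℝ) (πs : ℕ → Equiv.Perm (Fin (b * m))) (x0 : Fin d → ℝ) : ℕ → Fin d → ℝ
  | 0 => x0
  | k + 1 => inIter A g (η k) (πs k) (xSeq A g η πs x0 k) m

/-- the convex (Fenchel) conjugate of `f : ℝ → ℝ` -/
noncomputable def fconj (f : ℝ → ℝ) (y : ℝ) : ℝ := sSup (Set.range fun t => y * t - f t)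

/-- the Lagrangian `𝓛(x,y) = (1/n) ⟨A x, y⟩ - (1/n) ∑ᵢ ℓᵢ*(yⁱ)` -/
noncomputable def Lagr (A : Matrix (Fin (b * m)) (Fin d) ℝ) (ℓ : Fin (b * m) → ℝ → ℝ)
    (x : Fin d → ℝ) (y : Fin (b * m) → ℝ) : ℝ :=
  (1 / ((b * m : ℕ) : ℝ)) * ∑ i, dot (A i) x * y i
    - (1 / ((b * m : ℕ) : ℝ)) * ∑ i, fconj (ℓ i) (y i)

/-- `g` is a (global) subgradient of `f` at `t` -/
def IsSubgrad (f : ℝ → ℝ) (t g : ℝ) : Prop := ∀ s, f t + g * (s - t) ≤ f s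

/-- expectation with respect to the uniform distribution on a finite type -/
noncomputable def Eunif {α : Type*} [Fintype α] (F : α → ℝ) : ℝ :=
  (∑ a : α, F a) / (Fintype.card α : ℝ)

/-- extend a `K`-tuple of permutations to an `ℕ`-indexed sequence (by the identity) -/
def extSeq {K n : ℕ} (g : Fin K → Equiv.Perm (Fin n)) : ℕ → Equiv.Perm (Fin n) :=
  fun k => if h : k < K then g ⟨k, h⟩ else 1

theorem sq_vec_nonneg {ι : Type*} [Fintype ι] (x : ι → ℝ) : 0 ≤ sq x :=
  Finset.sum_nonneg fun _ _ => sq_nonneg _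

theorem opNorm_nonneg {α β : Type*} [Fintype α] [Fintype β] [DecidableEq β]
    (M : Matrix α β ℝ) : 0 ≤ opNorm M :=
  norm_nonneg _

/-- A quadratic form is bounded by the spectral norm of its matrix. -/
theorem dotProduct_mulVec_le_opNorm {α : Type*} [Fintype α] [DecidableEq α]
    (M : Matrix α α ℝ) (u : α → ℝ) : u ⬝ᵥ (M *ᵥ u) ≤ opNorm M * sq u := by
  have hu : ‖WithLp.toLp 2 u‖ ^ 2 = sq u := by
    simp [EuclideanSpace.norm_sq_eq, sq]
  have hin : inner ℝ (WithLp.toLp 2 u) (Matrix.toEuclideanLin M (WithLp.toLp 2 u))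
      = u ⬝ᵥ (M *ᵥ u) := by
    simp [PiLp.inner_apply, Matrix.toLpLin_apply, dotProduct, mul_comm]
  have hop := (LinearMap.toContinuousLinearMap (Matrix.toEuclideanLin M)).le_opNorm
    (WithLp.toLp 2 u)
  calc u ⬝ᵥ (M *ᵥ u)
      ≤ ‖WithLp.toLp 2 u‖ * ‖Matrix.toEuclideanLin M (WithLp.toLp 2 u)‖ :=
        hin ▸ real_inner_le_norm _ _
    _ ≤ ‖WithLp.toLp 2 u‖ * (opNorm M * ‖WithLp.toLp 2 u‖) :=
        mul_le_mul_of_nonneg_left hop (norm_nonneg _)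
    _ = opNorm M * sq u := by rw [← hu]; ring

/-- Masked combinations of the rows of `A` are controlled by the spectral norm of the weighted
sum of the masked Gram matrices. -/
theorem sum_sq_masked_le {ι κ τ : Type*} [Fintype ι] [Fintype κ] [Fintype τ] [DecidableEq ι]
    (A : Matrix ι τ ℝ) (L : ι → ℝ) (hL : ∀ i, 0 < L i) (c : κ → ι → ℝ) (w : ι → ℝ) :
    ∑ j, sq (fun t => ∑ p, c j p * (w p * A p t))
      ≤ opNorm (Matrix.diagonal (fun i => Real.sqrt (L i)) *
          (∑ j, Matrix.diagonal (c j) * (A * Aᵀ) * Matrix.diagonal (c j)) *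
          Matrix.diagonal (fun i => Real.sqrt (L i))) * wsq L w := by
  have hs : ∀ i, 0 < Real.sqrt (L i) := fun i => Real.sqrt_pos.2 (hL i)
  set u : ι → ℝ := fun i => w i / Real.sqrt (L i) with hu
  have hsq : sq u = wsq L w := by
    refine Finset.sum_congr rfl fun i _ => ?_
    rw [hu, div_pow, Real.sq_sqrt (hL i).le]
  have hDu : Matrix.diagonal (fun i => Real.sqrt (L i)) *ᵥ u = w := by
    ext i
    rw [Matrix.mulVec_diagonal, hu]
    exact mul_div_cancel₀ _ (hs i).ne'
  have huD : u ᵥ* Matrix.diagonal (fun i => Real.sqrt (L i)) = w := by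
    ext i
    rw [Matrix.vecMul_diagonal, hu]
    exact div_mul_cancel₀ _ (hs i).ne'
  have hmask : ∀ j, w ⬝ᵥ ((Matrix.diagonal (c j) * (A * Aᵀ) * Matrix.diagonal (c j)) *ᵥ w)
      = sq (fun t => ∑ p, c j p * (w p * A p t)) := by
    intro j
    have h1 : (w ᵥ* Matrix.diagonal (c j)) ᵥ* A = fun t => ∑ p, c j p * (w p * A p t) := by
      ext t
      simp only [Matrix.vecMul, dotProduct, Matrix.diagonal_apply, mul_ite, mul_zero,
        Finset.sum_ite_eq', Finset.mem_univ, if_true]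
      exact Finset.sum_congr rfl fun p _ => by ring
    have h2 : Aᵀ *ᵥ (Matrix.diagonal (c j) *ᵥ w) = fun t => ∑ p, c j p * (w p * A p t) := by
      ext t
      simp only [Matrix.mulVec, dotProduct, Matrix.diagonal_apply, ite_mul, zero_mul,
        Finset.sum_ite_eq, Finset.mem_univ, if_true, Matrix.transpose_apply]
      exact Finset.sum_congr rfl fun p _ => by ring
    rw [← Matrix.mulVec_mulVec, ← Matrix.mulVec_mulVec, Matrix.dotProduct_mulVec,
      ← Matrix.mulVec_mulVec, Matrix.dotProduct_mulVec, h1, h2]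
    simp [dotProduct, sq, pow_two]
  refine le_trans (le_of_eq ?_) (hsq ▸ dotProduct_mulVec_le_opNorm _ u)
  rw [← Matrix.mulVec_mulVec, ← Matrix.mulVec_mulVec, hDu, Matrix.dotProduct_mulVec, huD,
    Matrix.sum_mulVec, dotProduct_sum]
  exact Finset.sum_congr rfl fun j _ => (hmask j).symm

theorem idx_bijective (hb : 0 < b) :
    Function.Bijective fun q : Fin m × Fin b => idx b m q.1 q.2 := by
  constructor
  · rintro ⟨i, j⟩ ⟨i', j'⟩ h
    have h' : b * i.1 + j.1 = b * i'.1 + j'.1 := congrArg Fin.val h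
    have hdiv := congrArg (· / b) h'
    simp only [Nat.mul_add_div hb, Nat.div_eq_of_lt j.2, Nat.div_eq_of_lt j'.2,
      add_zero] at hdiv
    have hj : j.1 = j'.1 := by rw [hdiv] at h'; omega
    exact Prod.ext (Fin.ext hdiv) (Fin.ext hj)
  · intro p
    exact ⟨(⟨p.1 / b, Nat.div_lt_of_lt_mul p.2⟩, ⟨p.1 % b, Nat.mod_lt _ hb⟩),
      Fin.ext (Nat.div_add_mod _ _)⟩

theorem sum_idx (hb : 0 < b) (F : Fin (b * m) → ℝ) :
    ∑ p, F p = ∑ i : Fin m, ∑ j : Fin b, F (idx b m i j) := by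
  rw [← Fintype.sum_prod_type']
  exact (Function.Bijective.sum_comp (idx_bijective hb) F).symm

theorem idx_div (hb : 0 < b) (i : Fin m) (j : Fin b) : (idx b m i j).1 / b = i.1 := by
  simp [idx, Nat.mul_add_div hb, Nat.div_eq_of_lt j.2]

/-- The sum over one batch as a masked sum over all positions. -/
theorem sum_mask_block (hb : 0 < b) (F : Fin (b * m) → ℝ) (i : Fin m) :
    ∑ p : Fin (b * m), (if b * i.1 ≤ p.1 ∧ p.1 < b * (i.1 + 1) then (1 : ℝ) else 0) * F p
      = ∑ j : Fin b, F (idx b m i j) := by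
  have hmem : ∀ (i' : Fin m) (j : Fin b),
      (b * i.1 ≤ (idx b m i' j).1 ∧ (idx b m i' j).1 < b * (i.1 + 1)) ↔ i' = i := by
    intro i' j
    rw [Fin.ext_iff, ← idx_div hb i' j, mul_comm b i.1, mul_comm b (i.1 + 1),
      ← Nat.le_div_iff_mul_le hb, ← Nat.div_lt_iff_lt_mul hb]
    omega
  rw [sum_idx hb]
  simp only [hmem]
  rw [Finset.sum_eq_single i (fun i' _ hne => by simp [hne]) (by simp)]
  simp

theorem inIter_eq (hb : 0 < b) (A : Matrix (Fin (b * m)) (Fin d) ℝ)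
    (g : Fin (b * m) → ℝ → ℝ) (η : ℝ) (x0 : Fin d → ℝ) (t : Fin d) (k : ℕ) (hk : k ≤ m) :
    inIter A g η 1 x0 k t = x0 t - (η / b) * ∑ p : Fin (b * m),
      (if p.1 < b * k then (1 : ℝ) else 0) * (dualY A g η 1 x0 p * A p t) := by
  induction k with
  | zero => simp [inIter]
  | succ k ih =>
    have hkm : k < m := hk
    have hstep : ∑ j : Fin b, g (idx b m ⟨k, hkm⟩ j)
          (dot (A (idx b m ⟨k, hkm⟩ j)) (inIter A g η 1 x0 k)) * A (idx b m ⟨k, hkm⟩ j) t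
        = ∑ p : Fin (b * m), (if b * k ≤ p.1 ∧ p.1 < b * (k + 1) then (1 : ℝ) else 0) *
            (dualY A g η 1 x0 p * A p t) := by
      rw [sum_mask_block hb (fun p => dualY A g η 1 x0 p * A p t) ⟨k, hkm⟩]
      simp [dualY, idx_div hb]
    simp only [inIter, hkm, dif_pos, step, Equiv.Perm.one_apply]
    rw [hstep, ih hkm.le, sub_sub, ← mul_add, ← Finset.sum_add_distrib]
    congr 2
    refine Finset.sum_congr rfl fun p _ => ?_
    rw [← add_mul]
    congr 1
    have : b * k ≤ b * (k + 1) := Nat.mul_le_mul le_rfl (Nat.le_succ k)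
    split_ifs <;> first | omega | norm_num

theorem inIter_sub_eq (hb : 0 < b) (A : Matrix (Fin (b * m)) (Fin d) ℝ)
    (g : Fin (b * m) → ℝ → ℝ) (η : ℝ) (x0 : Fin d → ℝ) (t : Fin d) (i : Fin m) :
    inIter A g η 1 x0 m t - inIter A g η 1 x0 i.1 t = -((η / b) * ∑ p : Fin (b * m),
      (if b * i.1 ≤ p.1 then (1 : ℝ) else 0) * (dualY A g η 1 x0 p * A p t)) := by
  rw [inIter_eq hb A g η x0 t m le_rfl, inIter_eq hb A g η x0 t i.1 i.2.le,
    sub_sub_sub_cancel_left, ← mul_sub, ← mul_neg, ← Finset.sum_sub_distrib,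
    ← Finset.sum_neg_distrib]
  congr 1
  refine Finset.sum_congr rfl fun p _ => ?_
  rw [← sub_mul, ← neg_mul]
  congr 1
  have := p.2
  split_ifs <;> first | omega | norm_num

/-- First-order optimality for a sum of smooth functions of linear forms. -/
theorem sum_deriv_mul_eq_zero {ι τ : Type*} [Fintype ι] [Fintype τ] [DecidableEq τ]
    (A : Matrix ι τ ℝ) (ℓ ℓ' : ι → ℝ → ℝ) (hderiv : ∀ i t, HasDerivAt (ℓ i) (ℓ' i t) t)
    (x : τ → ℝ) (hmin : ∀ z : τ → ℝ, ∑ i, ℓ i (dot (A i) x) ≤ ∑ i, ℓ i (dot (A i) z)) (t : τ) :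
    ∑ i, ℓ' i (dot (A i) x) * A i t = 0 := by
  have hdot : ∀ i (s : ℝ), dot (A i) (x + s • Pi.single t 1) = dot (A i) x + s * A i t := by
    intro i s
    simp [dot, mul_add, Finset.sum_add_distrib, Pi.single_apply, mul_comm]
  have hd : HasDerivAt (fun s : ℝ => ∑ i, ℓ i (dot (A i) x + s * A i t))
      (∑ i, ℓ' i (dot (A i) x) * A i t) 0 := by
    refine HasDerivAt.fun_sum fun i _ => ?_
    have hlin : HasDerivAt (fun s : ℝ => dot (A i) x + s * A i t) (A i t) 0 := by
      simpa using ((hasDerivAt_id (0 : ℝ)).mul_const (A i t)).const_add (dot (A i) x)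
    refine HasDerivAt.comp (0 : ℝ) ?_ hlin
    simpa using hderiv i (dot (A i) x)
  refine IsLocalMin.hasDerivAt_eq_zero (Filter.Eventually.of_forall fun s => ?_) hd
  simpa [← hdot] using hmin (x + s • Pi.single t 1)

/-- Cauchy-Schwarz for a masked combination of rows. -/
theorem sq_masked_le_card {ι τ : Type*} [Fintype ι] [Fintype τ] (A : Matrix ι τ ℝ)
    (w : ι → ℝ) (P : ι → Prop) [DecidablePred P] :
    sq (fun t => ∑ p, (if P p then (1 : ℝ) else 0) * (w p * A p t))
      ≤ (Finset.univ.filter P).card * ∑ p, (w p) ^ 2 * sq (A p) := by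
  have hswap : ∑ p, (w p) ^ 2 * sq (A p) = ∑ t, ∑ p, (w p * A p t) ^ 2 := by
    rw [Finset.sum_comm]
    simp only [sq, Finset.mul_sum, mul_pow]
  rw [hswap, Finset.mul_sum]
  refine Finset.sum_le_sum fun t _ => ?_
  simp only [ite_mul, one_mul, zero_mul]
  rw [← Finset.sum_filter]
  exact sq_sum_le_card_mul_sum_sq.trans (mul_le_mul_of_nonneg_left
    (Finset.sum_le_sum_of_subset_of_nonneg (Finset.filter_subset _ _)
      fun _ _ _ => sq_nonneg _) (Nat.cast_nonneg _))

theorem card_filter_mul_le (i : ℕ) :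
    (Finset.univ.filter fun p : Fin (b * m) => b * i ≤ p.1).card = b * m - b * i := by
  have h := Finset.card_filter_add_card_filter_not (s := (Finset.univ : Finset (Fin (b * m))))
    (fun p => p.1 < b * i)
  simp only [not_lt, Finset.card_univ, Fintype.card_fin, Fin.card_filter_val_lt] at h
  omega

/-- If `∑ p, w p • A p = 0`, the tail sums of `w p • A p` starting at batch boundaries are bounded
by the total of the `(w p)² ‖A p‖²`. -/
theorem sum_sq_tail_le (hb : 0 < b) (hm : 0 < m) (A : Matrix (Fin (b * m)) (Fin d) ℝ)
    (w : Fin (b * m) → ℝ) (hw : ∀ t, ∑ p, w p * A p t = 0) :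
    ∑ i : Fin m, sq (fun t => ∑ p : Fin (b * m),
        (if b * i.1 ≤ p.1 then (1 : ℝ) else 0) * (w p * A p t))
      ≤ (((b * m : ℕ) : ℝ) - b) ^ 2 / b * ∑ p, (w p) ^ 2 * sq (A p) := by
  obtain ⟨k, rfl⟩ : ∃ k, m = k + 1 := ⟨m - 1, by omega⟩
  set Q := ∑ p, (w p) ^ 2 * sq (A p)
  have hQ : 0 ≤ Q := Finset.sum_nonneg fun p _ => mul_nonneg (sq_nonneg _) (sq_vec_nonneg _)
  have hb' : (0 : ℝ) < b := Nat.cast_pos.2 hb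
  rw [Fin.sum_univ_succ]
  have h0 : sq (fun t => ∑ p : Fin (b * (k + 1)),
      (if b * (0 : Fin (k + 1)).1 ≤ p.1 then (1 : ℝ) else 0) * (w p * A p t)) = 0 := by
    simp [hw, sq]
  have hle : ∀ i : Fin k, sq (fun t => ∑ p : Fin (b * (k + 1)),
      (if b * i.succ.1 ≤ p.1 then (1 : ℝ) else 0) * (w p * A p t)) ≤ (b * k : ℝ) * Q := by
    intro i
    refine (sq_masked_le_card A w _).trans (mul_le_mul_of_nonneg_right ?_ hQ)
    rw [card_filter_mul_le, ← Nat.mul_sub, ← Nat.cast_mul, Nat.cast_le]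
    exact Nat.mul_le_mul le_rfl (by simp)
  rw [h0, zero_add]
  refine (Finset.sum_le_sum fun i _ => hle i).trans (le_of_eq ?_)
  rw [Finset.sum_const, Finset.card_univ, Fintype.card_fin, nsmul_eq_mul]
  push_cast
  field_simp
  ring

/-- Cauchy-Schwarz followed by Young's inequality. -/
theorem neg_mul_sum_mul_le {κ τ : Type*} [Fintype κ] [Fintype τ] (R S : κ → τ → ℝ)
    (c K W : ℝ) (hK : 0 ≤ K) (hW : 0 ≤ W) (hR : c ^ 2 * ∑ i, sq (R i) ≤ K * W) :
    -(c * ∑ i, ∑ t, R i t * S i t) ≤ K * ∑ i, sq (S i) + W / 4 := by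
  have hC : 0 ≤ ∑ i, sq (S i) := Finset.sum_nonneg fun i _ => sq_vec_nonneg _
  have hcs : (∑ i, ∑ t, R i t * S i t) ^ 2 ≤ (∑ i, sq (R i)) * ∑ i, sq (S i) := by
    simp only [sq, ← Fintype.sum_prod_type']
    exact Finset.sum_mul_sq_le_sq_mul_sq _ _ _
  have hsq : (c * ∑ i, ∑ t, R i t * S i t) ^ 2 ≤ (K * ∑ i, sq (S i) + W / 4) ^ 2 := by
    nlinarith [mul_le_mul_of_nonneg_left hcs (sq_nonneg c), mul_le_mul_of_nonneg_right hR hC,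
      sq_nonneg (K * ∑ i, sq (S i) - W / 4)]
  exact (abs_le.1 (abs_le_of_sq_le_sq hsq (by positivity))).1 |> fun h => by linarith

/-- **Lemma A.4** (incremental gradient, second inner-product bound): for one epoch of
shuffled SGD with the fixed (identity) data ordering, `𝒯₂` is bounded as stated. -/
theorem stmt4
    (b m d : ℕ) (hb : 0 < b) (hm : 0 < m)
    (A : Matrix (Fin (b * m)) (Fin d) ℝ)
    (ℓ ℓ' : Fin (b * m) → ℝ → ℝ) (L : Fin (b * m) → ℝ)
    (hL : ∀ i, 0 < L i)
    (hconv : ∀ i, ConvexOn ℝ Set.univ (ℓ i))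
    (hderiv : ∀ i t, HasDerivAt (ℓ i) (ℓ' i t) t)
    (hsmooth : ∀ i s t, |ℓ' i s - ℓ' i t| ≤ L i * |s - t|)
    (xstar : Fin d → ℝ)
    (hmin : ∀ x : Fin d → ℝ,
      (1 / ((b * m : ℕ) : ℝ)) * ∑ i, ℓ i (dot (A i) xstar)
        ≤ (1 / ((b * m : ℕ) : ℝ)) * ∑ i, ℓ i (dot (A i) x))
    (η : ℝ) (hη : 0 < η)
    (xprev : Fin d → ℝ) (v : Fin (b * m) → ℝ) :
    let n : ℝ := ((b * m : ℕ) : ℝ)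
    let X : ℕ → Fin d → ℝ := inIter A ℓ' η 1 xprev
    let Y : Fin (b * m) → ℝ := dualY A ℓ' η 1 xprev
    let ystar : Fin (b * m) → ℝ := fun i => ℓ' i (dot (A i) xstar)
    let σ2 : ℝ := (1 / n) * ∑ i, (ystar i) ^ 2 * sq (A i)
    let Lh0 : ℝ := hatC A L 1
    let Lt0 : ℝ := tilC A L 1
    (η / n) * ∑ i : Fin m, ∑ j : Fin b,
        (v (idx b m i j) - Y (idx b m i j))
          * dot (A (idx b m i j)) (fun t => X m t - X i.1 t)
      ≤ (η ^ 3 * n / (b : ℝ) ^ 2) * Lh0 * Lt0 * wsq L (fun p => Y p - ystar p)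
        + (η / (2 * n)) * wsq L (fun p => v p - Y p)
        + min ((η ^ 3 * n / (b : ℝ) ^ 2) * Lh0 * Lt0 * wsq L ystar)
            ((η ^ 3 * (n - (b : ℝ)) ^ 2 / (b : ℝ) ^ 2) * Lt0 * σ2) := by
  intro n X Y ystar σ2 Lh0 Lt0
  have hb' : (0 : ℝ) < b := Nat.cast_pos.2 hb
  have hm' : (0 : ℝ) < m := Nat.cast_pos.2 hm
  have hn : n = b * m := Nat.cast_mul b m
  have hn' : 0 < n := hn ▸ mul_pos hb' hm'
  have hwsq : ∀ u : Fin (b * m) → ℝ, 0 ≤ wsq L u := fun u =>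
    Finset.sum_nonneg fun i _ => div_nonneg (sq_nonneg _) (hL i).le
  have hLt : 0 ≤ Lt0 := mul_nonneg (by positivity) (opNorm_nonneg _)
  have hLh_eq : ∀ u : Fin (b * m) → ℝ, ∑ i : Fin m, sq (fun t => ∑ p : Fin (b * m),
      (if b * i.1 ≤ p.1 then (1 : ℝ) else 0) * (u p * A p t)) ≤ m * n * Lh0 * wsq L u := by
    intro u
    refine (sum_sq_masked_le A L hL
      (fun (i : Fin m) p => if b * i.1 ≤ p.1 then (1 : ℝ) else 0) u).trans (le_of_eq ?_)
    congr 1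
    change _ = m * n * (1 / (m * n) * opNorm _)
    rw [← mul_assoc, mul_one_div_cancel (by positivity), one_mul]
    rfl
  have hLt_eq : ∀ u : Fin (b * m) → ℝ, ∑ i : Fin m, sq (fun t => ∑ j : Fin b,
      u (idx b m i j) * A (idx b m i j) t) ≤ b * Lt0 * wsq L u := by
    intro u
    have h := sum_sq_masked_le A L hL (fun (i : Fin m) p =>
      if b * i.1 ≤ p.1 ∧ p.1 < b * (i.1 + 1) then (1 : ℝ) else 0) u
    simp only [fun (i : Fin m) t => sum_mask_block hb (fun p => u p * A p t) i] at h
    refine h.trans (le_of_eq ?_)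
    congr 1
    change _ = b * (1 / b * opNorm _)
    rw [← mul_assoc, mul_one_div_cancel (by positivity), one_mul]
    rfl
  have hopt : ∀ t, ∑ p, ystar p * A p t = 0 := by
    refine sum_deriv_mul_eq_zero A ℓ ℓ' hderiv xstar fun z => ?_
    exact le_of_mul_le_mul_left (hmin z) (one_div_pos.2 hn')
  set R : Fin m → Fin d → ℝ := fun i t => ∑ j : Fin b,
    (v (idx b m i j) - Y (idx b m i j)) * A (idx b m i j) t with hR
  set S : (Fin (b * m) → ℝ) → Fin m → Fin d → ℝ := fun u i t => ∑ p : Fin (b * m),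
    (if b * i.1 ≤ p.1 then (1 : ℝ) else 0) * (u p * A p t) with hS
  have hSadd : ∀ i t, S Y i t = S (fun p => Y p - ystar p) i t + S ystar i t := by
    intro i t
    simp only [hS, ← Finset.sum_add_distrib]
    exact Finset.sum_congr rfl fun p _ => by ring
  have hlhs : ∑ i : Fin m, ∑ j : Fin b, (v (idx b m i j) - Y (idx b m i j))
        * dot (A (idx b m i j)) (fun t => X m t - X i.1 t)
      = -((η / b) * ∑ i, ∑ t, R i t * S (fun p => Y p - ystar p) i t)
        + -((η / b) * ∑ i, ∑ t, R i t * S ystar i t) := by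
    rw [← neg_add, ← mul_add, ← Finset.sum_add_distrib, Finset.mul_sum, ← Finset.sum_neg_distrib]
    refine Finset.sum_congr rfl fun i _ => ?_
    have hX : ∀ t, X m t - X i.1 t = -((η / b) * S Y i t) := fun t =>
      inIter_sub_eq hb A ℓ' η xprev t i
    rw [← Finset.sum_add_distrib]
    simp only [← mul_add, ← hSadd, hX]
    generalize S Y i = s
    simp only [dot, Finset.mul_sum]
    rw [Finset.sum_comm, ← Finset.sum_neg_distrib]
    refine Finset.sum_congr rfl fun t _ => ?_
    rw [hR, Finset.sum_mul, Finset.mul_sum, ← Finset.sum_neg_distrib]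
    exact Finset.sum_congr rfl fun j _ => by ring
  set W := wsq L fun p => v p - Y p with hW
  set K := η ^ 2 * Lt0 / b with hKdef
  have hK : 0 ≤ K := by positivity
  have hRK : (η / b) ^ 2 * ∑ i, sq (R i) ≤ K * W := by
    refine (mul_le_mul_of_nonneg_left (hLt_eq fun p => v p - Y p)
      (sq_nonneg (η / b))).trans (le_of_eq ?_)
    rw [hKdef, hW]
    field_simp
  have hT₁ := neg_mul_sum_mul_le R (S fun p => Y p - ystar p) _ K W hK (hwsq _) hRK
  have hT₂ := neg_mul_sum_mul_le R (S ystar) _ K W hK (hwsq _) hRK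
  have hKL : ∀ u, η / n * (K * ∑ i, sq (S u i)) ≤ η ^ 3 * n / b ^ 2 * Lh0 * Lt0 * wsq L u := by
    intro u
    refine (mul_le_mul_of_nonneg_left (mul_le_mul_of_nonneg_left (hLh_eq u) hK)
      (by positivity : 0 ≤ η / n)).trans (le_of_eq ?_)
    rw [hKdef, hn]
    field_simp
  have hKσ : η / n * (K * ∑ i, sq (S ystar i)) ≤ η ^ 3 * (n - b) ^ 2 / b ^ 2 * Lt0 * σ2 := by
    refine (mul_le_mul_of_nonneg_left (mul_le_mul_of_nonneg_left
      (sum_sq_tail_le hb hm A ystar hopt) hK) (by positivity : 0 ≤ η / n)).trans (le_of_eq ?_)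
    change η / n * (K * ((n - b) ^ 2 / b * _)) = _ * (1 / n * _)
    rw [hKdef]
    field_simp
  calc _ = η / n * (-((η / b) * ∑ i, ∑ t, R i t * S (fun p => Y p - ystar p) i t)
        + -((η / b) * ∑ i, ∑ t, R i t * S ystar i t)) := by rw [hlhs]
    _ ≤ η / n * ((K * ∑ i, sq (S (fun p => Y p - ystar p) i) + W / 4)
        + (K * ∑ i, sq (S ystar i) + W / 4)) :=
      mul_le_mul_of_nonneg_left (add_le_add hT₁ hT₂) (by positivity)
    _ = η / n * (K * ∑ i, sq (S (fun p => Y p - ystar p) i)) + η / (2 * n) * W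
        + η / n * (K * ∑ i, sq (S ystar i)) := by
      field_simp
      ring
    _ ≤ _ := add_le_add (add_le_add_left (hKL _) _) (le_min (hKL _) hKσ)
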